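/- Let N ≥ 1, d ≥ 1, and let M, M′ be functions from {k ∈ ℤ : |k| ≤ N−1} to the d×d complex matrices. Let A and B be the N×N block Toeplitz matrices with blocks A_{i,j} = M(i−j) and B_{i,j} = M′(i−j) for 0 ≤ i, j ≤ N−1. Then the product AB is a block Toeplitz matrix (i.e. its (i,j) block depends only on i−j) if and only if M(i)M′(j−N) = M(i−N)M′(j) for all i, j ∈ {1, …, N−1}. -/

import Mathlib

/-- The `(p, q)` block of the product of two `N×N` block Toeplitz matrices, as a function of
arbitrary integer indices. -/
def toeplitzProdBlock {R : Type*} [Ring R] (N : ℕ) (M M' : ℤ → R) (p q : ℤ) : R :=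
  ∑ k ∈ Finset.range N, M (p - k) * M' (k - q)

theorem toeplitzProdBlock_add_one_sub {R : Type*} [Ring R] {N : ℕ} (hN : 1 ≤ N) (M M' : ℤ → R)
    (p q : ℤ) :
    toeplitzProdBlock N M M' (p + 1) (q + 1) - toeplitzProdBlock N M M' p q =
      M (p + 1) * M' (-1 - q) - M (p + 1 - N) * M' (N - 1 - q) := by
  obtain ⟨n, rfl⟩ := Nat.exists_eq_add_of_le' hN
  unfold toeplitzProdBlock
  rw [Finset.sum_range_succ', Finset.sum_range_succ]
  have h : ∑ k ∈ Finset.range n, M (p + 1 - (k + 1 : ℕ)) * M' ((k + 1 : ℕ) - (q + 1)) =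
      ∑ k ∈ Finset.range n, M (p - k) * M' (k - q) := by
    refine Finset.sum_congr rfl fun k _ => ?_
    congr 2 <;> push_cast <;> ring
  rw [h, add_sub_add_left_eq_sub]
  congr 3 <;> (push_cast; ring)

theorem toeplitzProdBlock_add_nat {R : Type*} [Ring R] {N : ℕ} (hN : 1 ≤ N) {M M' : ℤ → R}
    (h : ∀ i j : ℤ, 1 ≤ i → i ≤ (N : ℤ) - 1 → 1 ≤ j → j ≤ (N : ℤ) - 1 →
      M i * M' (j - (N : ℤ)) = M (i - (N : ℤ)) * M' j)
    {p q : ℤ} (hp : 0 ≤ p) (hq : 0 ≤ q) (t : ℕ) (hpt : p + t < N) (hqt : q + t < N) :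
    toeplitzProdBlock N M M' (p + t) (q + t) = toeplitzProdBlock N M M' p q := by
  induction t with
  | zero => simp
  | succ t ih =>
    push_cast at hpt hqt
    rw [← ih (by lia) (by lia), ← sub_eq_zero]
    push_cast
    rw [← add_assoc, ← add_assoc, toeplitzProdBlock_add_one_sub hN, sub_eq_zero]
    have := h (p + t + 1) (N - 1 - (q + t)) (by lia) (by lia) (by lia) (by lia)
    rwa [show (N : ℤ) - 1 - (q + t) - N = -1 - (q + t) by ring] at this

theorem mul_apply_eq_toeplitzProdBlock {R n : Type*} [Ring R] [Fintype n] [DecidableEq n] {N : ℕ}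
    {M M' : ℤ → Matrix n n R} {A B : Matrix (Fin N × n) (Fin N × n) R}
    (hA : ∀ (i j : Fin N) (a b : n), A (i, a) (j, b) = M ((i : ℤ) - (j : ℤ)) a b)
    (hB : ∀ (i j : Fin N) (a b : n), B (i, a) (j, b) = M' ((i : ℤ) - (j : ℤ)) a b)
    (i j : Fin N) (a b : n) :
    (A * B) (i, a) (j, b) = toeplitzProdBlock N M M' i j a b := by
  simp only [toeplitzProdBlock, Matrix.mul_apply, Fintype.sum_prod_type, hA, hB, Finset.sum_range,
    Matrix.sum_apply]

/-- Let `A, B` be `N×N` block Toeplitz matrices with `d×d` blocks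
`A_{i,j} = M(i−j)`, `B_{i,j} = M'(i−j)`. Then `AB` is block Toeplitz (its `(i,j)` block
depends only on `i−j`) iff `M(i)M'(j−N) = M(i−N)M'(j)` for all `i, j ∈ {1, …, N−1}`. -/
theorem statement17 (N d : ℕ) (hN : 1 ≤ N)
    (M M' : ℤ → Matrix (Fin d) (Fin d) ℂ)
    (A B : Matrix (Fin N × Fin d) (Fin N × Fin d) ℂ)
    (hA : ∀ (i j : Fin N) (a b : Fin d), A (i, a) (j, b) = M ((i : ℤ) - (j : ℤ)) a b)
    (hB : ∀ (i j : Fin N) (a b : Fin d), B (i, a) (j, b) = M' ((i : ℤ) - (j : ℤ)) a b) :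
    (∀ i j i' j' : Fin N, (i : ℤ) - (j : ℤ) = (i' : ℤ) - (j' : ℤ) →
        ∀ a b : Fin d, (A * B) (i, a) (j, b) = (A * B) (i', a) (j', b))
      ↔ ∀ i j : ℤ, 1 ≤ i → i ≤ (N : ℤ) - 1 → 1 ≤ j → j ≤ (N : ℤ) - 1 →
          M i * M' (j - (N : ℤ)) = M (i - (N : ℤ)) * M' j := by
  simp only [mul_apply_eq_toeplitzProdBlock hA hB]
  constructor
  · intro h i j hi hiN hj hjN
    have hblock : toeplitzProdBlock N M M' (i - 1 + 1) (N - 1 - j + 1) =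
        toeplitzProdBlock N M M' (i - 1) (N - 1 - j) := by
      ext a b
      have := h ⟨i.toNat, by lia⟩ ⟨(N - j).toNat, by lia⟩ ⟨(i - 1).toNat, by lia⟩
        ⟨(N - 1 - j).toNat, by lia⟩ (by simp only; lia) a b
      convert this using 2 <;> simp only <;> lia
    rw [← sub_eq_zero, toeplitzProdBlock_add_one_sub hN, sub_eq_zero] at hblock
    rwa [show i - 1 + 1 = i by ring, show -1 - (N - 1 - j) = j - (N : ℤ) by ring,
      show (N : ℤ) - 1 - (N - 1 - j) = j by ring] at hblock
  · intro h i j i' j' hij a b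
    wlog hle : (i : ℕ) ≤ i' generalizing i j i' j'
    · exact (this i' j' i j hij.symm (by lia)).symm
    obtain ⟨t, ht⟩ := Nat.exists_eq_add_of_le hle
    have hi : (i' : ℤ) = i + t := by rw [ht]; push_cast; rfl
    have hj : (j' : ℤ) = j + t := by linarith
    rw [hi, hj, toeplitzProdBlock_add_nat hN h (by positivity) (by positivity) t (by omega)
      (by omega)]
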